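/- For every line l ∈ L, the vector δ_l = −θ·ε_l + Σ_{p ⊆ l} ε_p satisfies ⟨δ_l, ε_q⟩ = 0 for every point q ∈ P and ⟨δ_l, ε_m⟩ = θ for every line m ∈ L. -/

import Mathlib

open scoped Classical

namespace AllcockStmt12

noncomputable section

/-- `θ = i√3`. -/
def θ : ℂ := Complex.I * Real.sqrt 3

/-- The points of the projective plane `ℙ²(𝔽₃)`. -/
abbrev Pt := {W : Submodule (ZMod 3) (Fin 3 → ZMod 3) // Module.finrank (ZMod 3) W = 1}

/-- The lines of the projective plane `ℙ²(𝔽₃)`. -/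
abbrev Ln := {W : Submodule (ZMod 3) (Fin 3 → ZMod 3) // Module.finrank (ZMod 3) W = 2}

/-- The Gram matrix `G(I_26)` of the incidence diagram of `ℙ²(𝔽₃)`. -/
def G : Matrix (Pt ⊕ Ln) (Pt ⊕ Ln) ℂ := fun u v =>
  match u, v with
  | Sum.inl p, Sum.inl q => if p = q then 3 else 0
  | Sum.inl p, Sum.inr l => if p.1 ≤ l.1 then θ else 0
  | Sum.inr l, Sum.inl p => if p.1 ≤ l.1 then -θ else 0
  | Sum.inr l, Sum.inr m => if l = m then 3 else 0

/-- The sesquilinear form `⟨u, v⟩ = Σ_{i,j} u_i · G_{ij} · conj (v_j)` on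
`ℂ^(P ⊔ L)`, linear in the first variable and Hermitian. -/
def B (u v : (Pt ⊕ Ln) → ℂ) : ℂ :=
  ∑ i, ∑ j, u i * G i j * (starRingEnd ℂ) (v j)

/-- The standard basis vector `ε_i` of `ℂ^(P ⊔ L)`. -/
def ε (i : Pt ⊕ Ln) : (Pt ⊕ Ln) → ℂ := Pi.single i 1

/-- `δ_l = -θ·ε_l + Σ_{p ⊆ l} ε_p`. -/
def δ (l : Ln) : (Pt ⊕ Ln) → ℂ :=
  (-θ) • ε (Sum.inr l) +
    ∑ p ∈ Finset.univ.filter (fun p : Pt => p.1 ≤ l.1), ε (Sum.inl p)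

lemma θ_mul_θ : θ * θ = -3 := by
  have h : ((Real.sqrt 3 : ℝ) : ℂ) * (Real.sqrt 3 : ℝ) = 3 := by
    rw [← Complex.ofReal_mul, Real.mul_self_sqrt (by norm_num)]
    norm_num
  calc θ * θ = (Complex.I * Complex.I) * (((Real.sqrt 3 : ℝ) : ℂ) * (Real.sqrt 3 : ℝ)) := by
        unfold θ; ring
    _ = -3 := by rw [h, Complex.I_mul_I]; ring

lemma B_ε_right (u : Pt ⊕ Ln → ℂ) (j : Pt ⊕ Ln) : B u (ε j) = ∑ i, u i * G i j := by
  simp [B, ε, Pi.single_apply, apply_ite (starRingEnd ℂ)]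

lemma δ_inl (l : Ln) (p : Pt) : δ l (Sum.inl p) = if p.1 ≤ l.1 then 1 else 0 := by
  simp [δ, ε, Finset.sum_apply, Pi.single_apply]

lemma δ_inr (l m : Ln) : δ l (Sum.inr m) = if m = l then -θ else 0 := by
  simp [δ, ε, Finset.sum_apply, Pi.single_apply]
  split_ifs <;> simp

lemma B_δ_ε (l : Ln) (j : Pt ⊕ Ln) :
    B (δ l) (ε j) = (∑ p : Pt with p.1 ≤ l.1, G (Sum.inl p) j) - θ * G (Sum.inr l) j := by
  simp [B_ε_right, Fintype.sum_sum_type, δ_inl, δ_inr, Finset.sum_filter, sub_eq_add_neg]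

/-- A line of `ℙ²(𝔽₃)` has four points. -/
lemma card_points_le (l : Ln) : (Finset.univ.filter fun p : Pt => p.1 ≤ l.1).card = 4 := by
  have e : {p : Pt // p.1 ≤ l.1} ≃
      {W : Submodule (ZMod 3) l.1 // Module.finrank (ZMod 3) W = 1} :=
    { toFun := fun p => ⟨p.1.1.comap l.1.subtype, by
        rw [← Submodule.finrank_map_subtype_eq, Submodule.map_comap_subtype,
          inf_eq_right.mpr p.2, p.1.2]⟩
      invFun := fun W => ⟨⟨W.1.map l.1.subtype, by
        rw [Submodule.finrank_map_subtype_eq, W.2]⟩, Submodule.map_subtype_le _ _⟩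
      left_inv := fun p => by
        ext1; ext1
        simp [Submodule.map_comap_subtype, inf_eq_right.mpr p.2]
      right_inv := fun W => by
        ext1
        exact Submodule.comap_map_eq_of_injective l.1.injective_subtype _ }
  rw [← Fintype.card_subtype, ← Nat.card_eq_fintype_card,
    Nat.card_congr (e.trans (Projectivization.equivSubmodule (ZMod 3) l.1).symm),
    Projectivization.card_of_finrank_two _ _ l.2, Nat.card_zmod]

/-- Two distinct lines of `ℙ²(𝔽₃)` meet in a point. -/
lemma finrank_inf_eq_one {l m : Ln} (h : l ≠ m) :
    Module.finrank (ZMod 3) ↥(l.1 ⊓ m.1) = 1 := by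
  have hadd := Submodule.finrank_sup_add_finrank_inf_eq l.1 m.1
  have hsup : Module.finrank (ZMod 3) ↥(l.1 ⊔ m.1) ≤ 3 := by
    simpa using Submodule.finrank_le (l.1 ⊔ m.1)
  have hinf : ¬ 2 ≤ Module.finrank (ZMod 3) ↥(l.1 ⊓ m.1) := fun h2 => by
    have hl := Submodule.eq_of_le_of_finrank_le (inf_le_left : l.1 ⊓ m.1 ≤ l.1) (l.2.trans_le h2)
    have hm := Submodule.eq_of_le_of_finrank_le (inf_le_right : l.1 ⊓ m.1 ≤ m.1) (m.2.trans_le h2)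
    exact h (Subtype.ext (hl.symm.trans hm))
  have hl := l.2
  have hm := m.2
  omega

lemma card_points_le_inf {l m : Ln} (h : l ≠ m) :
    (Finset.univ.filter fun p : Pt => p.1 ≤ l.1 ∧ p.1 ≤ m.1).card = 1 := by
  rw [Finset.card_eq_one]
  refine ⟨⟨l.1 ⊓ m.1, finrank_inf_eq_one h⟩, ?_⟩
  ext p
  simp only [Finset.mem_filter_univ, Finset.mem_singleton, ← le_inf_iff, Subtype.ext_iff]
  exact ⟨fun hp => Submodule.eq_of_le_of_finrank_eq hp (p.2.trans (finrank_inf_eq_one h).symm),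
    fun hp => hp.le⟩

/-- For every line `l`, the vector `δ_l` satisfies
`⟨δ_l, ε_q⟩ = 0` for every point `q` and `⟨δ_l, ε_m⟩ = θ` for every line `m`. -/
theorem delta_pairings :
    ∀ l : Ln,
      (∀ q : Pt, B (δ l) (ε (Sum.inl q)) = 0) ∧
      (∀ m : Ln, B (δ l) (ε (Sum.inr m)) = θ) := by
  intro l
  refine ⟨fun q => ?_, fun m => ?_⟩
  · rw [B_δ_ε]
    by_cases hq : q.1 ≤ l.1 <;> simp [G, hq, θ_mul_θ]
  · have hsum : ∑ p : Pt with p.1 ≤ l.1, G (Sum.inl p) (Sum.inr m) =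
        (Finset.univ.filter fun p : Pt => p.1 ≤ l.1 ∧ p.1 ≤ m.1).card * θ := by
      simp [G, ← Finset.sum_filter, Finset.filter_filter]
    rw [B_δ_ε, hsum]
    by_cases h : l = m
    · subst h
      simp only [and_self, card_points_le, G, if_true]
      push_cast
      ring
    · simp [card_points_le_inf h, G, h]

end

end AllcockStmt12
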